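/- (Three-dimensional version of Theorem 2) For every optimal conditional machine U there exists a constant c ∈ ℕ such that the following holds. For all strings a, b, e, let δ = log C(a) + log C(b) + log C(e) + max(0, C(a) + C(b) + C(e) − C(a,b,e)). Then for all integers α, β, γ with c·δ ≤ α ≤ C(a) − c·δ, c·δ ≤ β ≤ C(b) − c·δ, and c·δ ≤ γ ≤ C(e) − c·δ, there exists a string y such that |C(a|y) − α| ≤ c, |C(b|y) − β| ≤ c, and |C(e|y) − γ| ≤ c (differences in ℤ). -/

import Mathlib

/-- A string is a finite binary string. -/
abbrev Str : Type := List Bool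

/-- A conditional machine: a partial computable function mapping a pair of
strings `(p, y)` to a string. -/
abbrev CondMachine : Type := {V : Str × Str →. Str // Partrec V}

/-- `condC V x y` is `C_V(x|y)`: the least length of a program `p` with
`V (p, y) = x`, as an element of `ℕ∞` (it is `⊤` if no such `p` exists). -/
noncomputable def condC (V : CondMachine) (x y : Str) : ℕ∞ :=
  sInf {n : ℕ∞ | ∃ p : Str, x ∈ V.1 (p, y) ∧ (p.length : ℕ∞) = n}

/-- A conditional machine `U` is optimal if for every conditional machine `V`
there is a constant `d` with `C_U(x|y) ≤ C_V(x|y) + d` for all `x, y`. -/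
def OptimalMachine (U : CondMachine) : Prop :=
  ∀ V : CondMachine, ∃ d : ℕ, ∀ x y : Str, condC U x y ≤ condC V x y + (d : ℕ∞)

/-- For an optimal machine all complexities are finite natural numbers. -/
noncomputable def KC (U : CondMachine) (x y : Str) : ℕ := (condC U x y).toNat

/-- `log2 n = Nat.log 2 (n + 2)`, so `log2 n ≥ 1`. -/
def log2 (n : ℕ) : ℕ := Nat.log 2 (n + 2)

/-! ### A cubical Sperner lemma in dimension three -/

section Sperner

/-- Indicator modulo 2 of the labels `0, 1, 2, 3` all occurring on a tetrahedron. -/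
def tetraInd (a b c d : Fin 4) : ZMod 2 :=
  if ∀ l : Fin 4, l = a ∨ l = b ∨ l = c ∨ l = d then 1 else 0

/-- Indicator modulo 2 of the labels `0, 1, 2` all occurring on a triangle. -/
def triInd (a b c : Fin 4) : ZMod 2 :=
  if ∀ l : Fin 4, l ≤ 2 → l = a ∨ l = b ∨ l = c then 1 else 0

/-- Indicator modulo 2 of the labels `0, 1` both occurring on an edge. -/
def edgeInd (a b : Fin 4) : ZMod 2 :=
  if ∀ l : Fin 4, l ≤ 1 → l = a ∨ l = b then 1 else 0

/-- Indicator modulo 2 of the label `0`. -/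
def zeroInd (a : Fin 4) : ZMod 2 := if a = 0 then 1 else 0

theorem tetraInd_eq (a b c d : Fin 4) :
    tetraInd a b c d = triInd b c d + triInd a c d + triInd a b d + triInd a b c := by
  revert a b c d; decide +kernel

theorem triInd_eq {a b c : Fin 4} (ha : a ≤ 2) (hb : b ≤ 2) (hc : c ≤ 2) :
    triInd a b c = edgeInd b c + edgeInd a c + edgeInd a b := by
  revert a b c; decide +kernel

theorem edgeInd_eq {a b : Fin 4} (ha : a ≤ 1) (hb : b ≤ 1) :
    edgeInd a b = zeroInd b + zeroInd a := by
  revert a b; decide +kernel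

theorem triInd_eq_zero {m a b c : Fin 4} (hm : m ≤ 2) (ha : a ≠ m) (hb : b ≠ m) (hc : c ≠ m) :
    triInd a b c = 0 := by
  revert m a b c; decide +kernel

theorem edgeInd_eq_zero {m a b : Fin 4} (hm : m ≤ 1) (ha : a ≠ m) (hb : b ≠ m) :
    edgeInd a b = 0 := by
  revert m a b; decide +kernel

theorem sum_range_succ_add_self (f : ℕ → ZMod 2) (n : ℕ) :
    ∑ i ∈ Finset.range n, (f (i + 1) + f i) = f n + f 0 := by
  simpa only [CharTwo.sub_eq_add] using Finset.sum_range_sub f n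

/-- One-dimensional parity count. -/
theorem sum_edgeInd {N : ℕ} {lab : ℕ → Fin 4} (h0 : lab 0 ≠ 0) (hN : lab N = 0)
    (hle : ∀ i, lab i ≤ 1) :
    ∑ i ∈ Finset.range N, edgeInd (lab i) (lab (i + 1)) = 1 := by
  simp only [edgeInd_eq (hle _) (hle _)]
  rw [sum_range_succ_add_self (fun i => zeroInd (lab i))]
  simp [zeroInd, h0, hN]

/-- The count of fully labelled triangles in the unit square at `(i, j)`. -/
def squareInd (lab : ℕ → ℕ → Fin 4) (i j : ℕ) : ZMod 2 :=
  triInd (lab i j) (lab (i + 1) j) (lab (i + 1) (j + 1)) +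
    triInd (lab i j) (lab i (j + 1)) (lab (i + 1) (j + 1))

theorem squareInd_eq_zero {lab : ℕ → ℕ → Fin 4} {m : Fin 4} (hm : m ≤ 2)
    (h : ∀ i j, lab i j ≠ m) (i j : ℕ) : squareInd lab i j = 0 := by
  simp only [squareInd, triInd_eq_zero hm (h _ _) (h _ _) (h _ _), add_zero]

/-- Two-dimensional parity count. -/
theorem sum_squareInd {M N : ℕ} {lab : ℕ → ℕ → Fin 4}
    (h0 : ∀ j, lab 0 j ≠ 0) (hM : ∀ j, lab M j = 0)
    (h1 : ∀ i, lab i 0 ≠ 1) (hN : ∀ i, lab i N ≤ 1) (hle : ∀ i j, lab i j ≤ 2) :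
    ∑ i ∈ Finset.range M, ∑ j ∈ Finset.range N, squareInd lab i j = 1 := by
  have key (i j : ℕ) : squareInd lab i j =
      (edgeInd (lab i (j + 1)) (lab (i + 1) (j + 1)) + edgeInd (lab i j) (lab (i + 1) j)) +
      (edgeInd (lab (i + 1) j) (lab (i + 1) (j + 1)) + edgeInd (lab i j) (lab i (j + 1))) := by
    simp only [squareInd, triInd_eq (hle _ _) (hle _ _) (hle _ _)]
    have := CharTwo.add_self_eq_zero (edgeInd (lab i j) (lab (i + 1) (j + 1)))
    linear_combination this
  have hM1 (j : ℕ) : lab M j ≠ 1 := by simp [hM]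
  have horizontal : ∑ i ∈ Finset.range M, ∑ j ∈ Finset.range N,
      (edgeInd (lab i (j + 1)) (lab (i + 1) (j + 1)) + edgeInd (lab i j) (lab (i + 1) j)) = 1 := by
    rw [← sum_edgeInd (lab := (lab · N)) (h0 N) (hM N) hN]
    refine Finset.sum_congr rfl fun i _ => ?_
    rw [sum_range_succ_add_self (fun j => edgeInd (lab i j) (lab (i + 1) j)),
      edgeInd_eq_zero le_rfl (h1 _) (h1 _), add_zero]
  have vertical : ∑ i ∈ Finset.range M, ∑ j ∈ Finset.range N,
      (edgeInd (lab (i + 1) j) (lab (i + 1) (j + 1)) + edgeInd (lab i j) (lab i (j + 1))) = 0 := by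
    rw [Finset.sum_comm]
    refine Finset.sum_eq_zero fun j _ => ?_
    rw [sum_range_succ_add_self (fun i => edgeInd (lab i j) (lab i (j + 1))),
      edgeInd_eq_zero (by decide) (h0 _) (h0 _), edgeInd_eq_zero le_rfl (hM1 _) (hM1 _), add_zero]
  simp only [key, Finset.sum_add_distrib] at horizontal vertical ⊢
  linear_combination horizontal + vertical

/-- The count of fully labelled tetrahedra in the unit cube at `(i, j, k)`. -/
def cubeInd (lab : ℕ → ℕ → ℕ → Fin 4) (i j k : ℕ) : ZMod 2 :=
  tetraInd (lab i j k) (lab (i + 1) j k) (lab (i + 1) (j + 1) k) (lab (i + 1) (j + 1) (k + 1)) +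
  tetraInd (lab i j k) (lab (i + 1) j k) (lab (i + 1) j (k + 1)) (lab (i + 1) (j + 1) (k + 1)) +
  tetraInd (lab i j k) (lab i (j + 1) k) (lab (i + 1) (j + 1) k) (lab (i + 1) (j + 1) (k + 1)) +
  tetraInd (lab i j k) (lab i (j + 1) k) (lab i (j + 1) (k + 1)) (lab (i + 1) (j + 1) (k + 1)) +
  tetraInd (lab i j k) (lab i j (k + 1)) (lab (i + 1) j (k + 1)) (lab (i + 1) (j + 1) (k + 1)) +
  tetraInd (lab i j k) (lab i j (k + 1)) (lab i (j + 1) (k + 1)) (lab (i + 1) (j + 1) (k + 1))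

theorem cubeInd_eq (lab : ℕ → ℕ → ℕ → Fin 4) (i j k : ℕ) :
    cubeInd lab i j k =
      (squareInd (fun i j => lab i j (k + 1)) i j + squareInd (fun i j => lab i j k) i j) +
      (squareInd (fun i k => lab i (j + 1) k) i k + squareInd (fun i k => lab i j k) i k) +
      (squareInd (fun j k => lab (i + 1) j k) j k + squareInd (fun j k => lab i j k) j k) := by
  simp only [cubeInd, squareInd, tetraInd_eq]
  have h2 : (2 : ZMod 2) = 0 := rfl
  ring_nf
  simp only [h2, mul_zero, add_zero]

/-- Three-dimensional parity count. -/
theorem sum_cubeInd {M N P : ℕ} {lab : ℕ → ℕ → ℕ → Fin 4}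
    (h0 : ∀ j k, lab 0 j k ≠ 0) (hM : ∀ j k, lab M j k = 0)
    (h1 : ∀ i k, lab i 0 k ≠ 1) (hN : ∀ i k, lab i N k ≤ 1)
    (h2 : ∀ i j, lab i j 0 ≠ 2) (hP : ∀ i j, lab i j P ≤ 2) :
    ∑ i ∈ Finset.range M, ∑ j ∈ Finset.range N, ∑ k ∈ Finset.range P, cubeInd lab i j k = 1 := by
  have hM1 (j k : ℕ) : lab M j k ≠ 1 := by simp [hM]
  have hN2 (i k : ℕ) : lab i N k ≠ 2 := fun h => absurd (hN i k) (by rw [h]; decide)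
  have first : ∑ i ∈ Finset.range M, ∑ j ∈ Finset.range N, ∑ k ∈ Finset.range P,
      (squareInd (fun i j => lab i j (k + 1)) i j + squareInd (fun i j => lab i j k) i j) = 1 := by
    rw [← sum_squareInd (lab := (lab · · P)) (h0 · P) (hM · P) (h1 · P) (hN · P) hP]
    refine Finset.sum_congr rfl fun i _ => Finset.sum_congr rfl fun j _ => ?_
    rw [sum_range_succ_add_self (fun k => squareInd (fun i j => lab i j k) i j),
      squareInd_eq_zero le_rfl h2, add_zero]
  have second : ∑ i ∈ Finset.range M, ∑ j ∈ Finset.range N, ∑ k ∈ Finset.range P,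
      (squareInd (fun i k => lab i (j + 1) k) i k + squareInd (fun i k => lab i j k) i k) = 0 := by
    refine Finset.sum_eq_zero fun i _ => ?_
    rw [Finset.sum_comm]
    refine Finset.sum_eq_zero fun k _ => ?_
    rw [sum_range_succ_add_self (fun j => squareInd (fun i k => lab i j k) i k),
      squareInd_eq_zero (by decide) h1, squareInd_eq_zero le_rfl hN2, add_zero]
  have third : ∑ i ∈ Finset.range M, ∑ j ∈ Finset.range N, ∑ k ∈ Finset.range P,
      (squareInd (fun j k => lab (i + 1) j k) j k + squareInd (fun j k => lab i j k) j k) = 0 := by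
    rw [Finset.sum_comm]
    refine Finset.sum_eq_zero fun j _ => ?_
    rw [Finset.sum_comm]
    refine Finset.sum_eq_zero fun k _ => ?_
    rw [sum_range_succ_add_self (fun i => squareInd (fun j k => lab i j k) j k),
      squareInd_eq_zero (by decide) h0, squareInd_eq_zero (by decide) hM1, add_zero]
  simp only [cubeInd_eq, Finset.sum_add_distrib] at first second third ⊢
  linear_combination first + second + third

theorem forall_mem_of_tetraInd_ne_zero {a b c d : Fin 4} (h : tetraInd a b c d ≠ 0) (l : Fin 4) :
    l = a ∨ l = b ∨ l = c ∨ l = d := by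
  unfold tetraInd at h
  split_ifs at h with hl
  · exact hl l
  · exact absurd rfl h

/-- Sperner's lemma for the cubical grid: a labelling satisfying the boundary conditions has a
unit cube whose vertices carry all four labels. -/
theorem exists_fully_labelled_cube {M N P : ℕ} {lab : ℕ → ℕ → ℕ → Fin 4}
    (h0 : ∀ j k, lab 0 j k ≠ 0) (hM : ∀ j k, lab M j k = 0)
    (h1 : ∀ i k, lab i 0 k ≠ 1) (hN : ∀ i k, lab i N k ≤ 1)
    (h2 : ∀ i j, lab i j 0 ≠ 2) (hP : ∀ i j, lab i j P ≤ 2) :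
    ∃ i j k : ℕ, ∀ l : Fin 4, ∃ u v w : Bool,
      lab (i + u.toNat) (j + v.toNat) (k + w.toNat) = l := by
  have hsum := sum_cubeInd h0 hM h1 hN h2 hP
  obtain ⟨i, -, hi⟩ := Finset.exists_ne_zero_of_sum_ne_zero (hsum.trans_ne one_ne_zero)
  obtain ⟨j, -, hj⟩ := Finset.exists_ne_zero_of_sum_ne_zero hi
  obtain ⟨k, -, hk⟩ := Finset.exists_ne_zero_of_sum_ne_zero hj
  refine ⟨i, j, k, fun l => ?_⟩
  by_contra hl
  simp only [Bool.exists_bool, Bool.toNat_false, Bool.toNat_true, add_zero, not_or] at hl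
  have vanish {a b c d : Fin 4} (ha : a ≠ l) (hb : b ≠ l) (hc : c ≠ l) (hd : d ≠ l) :
      tetraInd a b c d = 0 := by
    by_contra h
    rcases forall_mem_of_tetraInd_ne_zero h l with h | h | h | h <;> simp_all
  apply hk
  obtain ⟨⟨⟨h000, h001⟩, h010, h011⟩, ⟨h100, h101⟩, h110, h111⟩ := hl
  simp only [cubeInd, vanish h000 h100 h110 h111, vanish h000 h100 h101 h111,
    vanish h000 h010 h110 h111, vanish h000 h010 h011 h111, vanish h000 h001 h101 h111,
    vanish h000 h001 h011 h111, add_zero]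

/-- A discrete Poincaré–Miranda theorem: three integer functions on the grid that vary by at most
`L` within unit cubes and change sign between opposite faces are simultaneously at most `L` in
absolute value at some point. -/
theorem exists_abs_le_of_sign_change {M N P : ℕ} {L : ℤ} {f g h : ℕ → ℕ → ℕ → ℤ}
    (f0 : ∀ j k, 0 ≤ f 0 j k) (fM : ∀ j k, f M j k < 0)
    (g0 : ∀ i k, 0 ≤ g i 0 k) (gN : ∀ i k, g i N k < 0)
    (h0 : ∀ i j, 0 ≤ h i j 0) (hP : ∀ i j, h i j P < 0)
    (fL : ∀ i j k (u v w : Bool), |f (i + u.toNat) (j + v.toNat) (k + w.toNat) - f i j k| ≤ L)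
    (gL : ∀ i j k (u v w : Bool), |g (i + u.toNat) (j + v.toNat) (k + w.toNat) - g i j k| ≤ L)
    (hL : ∀ i j k (u v w : Bool), |h (i + u.toNat) (j + v.toNat) (k + w.toNat) - h i j k| ≤ L) :
    ∃ i j k, |f i j k| ≤ L ∧ |g i j k| ≤ L ∧ |h i j k| ≤ L := by
  let lab (i j k : ℕ) : Fin 4 :=
    if f i j k < 0 then 0 else if g i j k < 0 then 1 else if h i j k < 0 then 2 else 3
  have lab0 {i j k} (hl : lab i j k = 0) : f i j k < 0 := by
    simp only [lab] at hl; split_ifs at hl <;> first | assumption | exact absurd hl (by decide)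
  have lab1 {i j k} (hl : lab i j k = 1) : g i j k < 0 := by
    simp only [lab] at hl; split_ifs at hl <;> first | assumption | exact absurd hl (by decide)
  have lab2 {i j k} (hl : lab i j k = 2) : h i j k < 0 := by
    simp only [lab] at hl; split_ifs at hl <;> first | assumption | exact absurd hl (by decide)
  have lab3 {i j k} (hl : lab i j k = 3) : 0 ≤ f i j k ∧ 0 ≤ g i j k ∧ 0 ≤ h i j k := by
    simp only [lab] at hl; split_ifs at hl <;> omega
  obtain ⟨i, j, k, hijk⟩ := exists_fully_labelled_cube (M := M) (N := N) (P := P) (lab := lab)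
    (fun j k hl => (lab0 hl).not_ge (f0 j k)) (fun j k => if_pos (fM j k))
    (fun i k hl => (lab1 hl).not_ge (g0 i k))
    (fun i k => by simp only [lab, if_pos (gN i k)]; split_ifs <;> decide)
    (fun i j hl => (lab2 hl).not_ge (h0 i j))
    (fun i j => by simp only [lab, if_pos (hP i j)]; split_ifs <;> decide)
  obtain ⟨u₃, v₃, w₃, hl₃⟩ := hijk 3
  have bound {F : ℕ → ℕ → ℕ → ℤ}
      (FL : ∀ i j k (u v w : Bool), |F (i + u.toNat) (j + v.toNat) (k + w.toNat) - F i j k| ≤ L)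
      {u v w : Bool} (neg : F (i + u.toNat) (j + v.toNat) (k + w.toNat) < 0)
      (nonneg : 0 ≤ F (i + u₃.toNat) (j + v₃.toNat) (k + w₃.toNat)) : |F i j k| ≤ L := by
    have hn := abs_le.1 (FL i j k u v w)
    have hp := abs_le.1 (FL i j k u₃ v₃ w₃)
    exact abs_le.2 ⟨by linarith, by linarith⟩
  obtain ⟨_, _, _, hl₀⟩ := hijk 0
  obtain ⟨_, _, _, hl₁⟩ := hijk 1
  obtain ⟨_, _, _, hl₂⟩ := hijk 2
  exact ⟨i, j, k, bound fL (lab0 hl₀) (lab3 hl₃).1, bound gL (lab1 hl₁) (lab3 hl₃).2.1,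
    bound hL (lab2 hl₂) (lab3 hl₃).2.2⟩

end Sperner

/-! ### Self-delimiting codes -/

section Codes

/-- A self-delimiting code of a string: its length in unary followed by the string. -/
def selfDelim (h : Str) : Str := h.map (fun _ => true) ++ false :: h

/-- Splits off the leading self-delimiting code of a string. -/
def splitDelim (z : Str) : Str × Str :=
  let k := (z.takeWhile id).length
  ((z.drop (k + 1)).take k, (z.drop (k + 1)).drop k)

theorem length_selfDelim (h : Str) : (selfDelim h).length = 2 * h.length + 1 := by
  simp [selfDelim]; omega

theorem splitDelim_selfDelim_append (h r : Str) : splitDelim (selfDelim h ++ r) = (h, r) := by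
  have hk : ((selfDelim h ++ r).takeWhile id).length = h.length := by
    simp [selfDelim]
  have hd : (selfDelim h ++ r).drop (h.length + 1) = h ++ r := by
    simp [selfDelim, List.drop_append]
  simp [splitDelim, hk, hd]

theorem primrec_selfDelim : Primrec selfDelim :=
  Primrec.list_append.comp (Primrec.list_map Primrec.id (Primrec.const true).to₂)
    (Primrec.list_cons.comp (Primrec.const false) Primrec.id)

theorem primrec_splitDelim : Primrec splitDelim := by
  have hk : Primrec fun z : Str => (z.takeWhile id).length :=
    Primrec.list_length.comp (Primrec.list_takeWhile Primrec.id)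
  have hd : Primrec fun z : Str => z.drop ((z.takeWhile id).length + 1) :=
    Primrec.list_drop.comp (Primrec.succ.comp hk) Primrec.id
  exact (Primrec.list_take.comp hk hd).pair (Primrec.list_drop.comp hk hd)

/-- The number with given digits in bijective base two, least significant first: `false` and
`true` stand for the digits `1` and `2`. -/
def binVal (h : Str) : ℕ := h.foldr (fun b n => bif b then n + n + 2 else n + n + 1) 0

theorem primrec_binVal : Primrec binVal := by
  have hdbl : Primrec fun q : Str × Bool × ℕ => q.2.2 + q.2.2 :=
    Primrec.nat_add.comp (Primrec.snd.comp Primrec.snd) (Primrec.snd.comp Primrec.snd)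
  exact Primrec.list_foldr Primrec.id (Primrec.const 0)
    (Primrec.cond (Primrec.fst.comp Primrec.snd) (Primrec.succ.comp (Primrec.succ.comp hdbl))
      (Primrec.succ.comp hdbl)).to₂

theorem exists_binVal_eq (n : ℕ) : ∃ h : Str, binVal h = n ∧ h.length ≤ Nat.log 2 (n + 1) := by
  induction n using Nat.strong_induction_on with
  | _ n ih =>
    rcases Nat.eq_zero_or_pos n with rfl | hn
    · exact ⟨[], rfl, Nat.zero_le _⟩
    obtain ⟨h, hv, hl⟩ := ih ((n - 1) / 2) (by omega)
    have hlog : Nat.log 2 (n + 1) = Nat.log 2 ((n - 1) / 2 + 1) + 1 := by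
      rw [Nat.log_of_one_lt_of_le one_lt_two (by omega)]
      congr 2
      omega
    have hcons (b : Bool) : binVal (b :: h) =
        bif b then binVal h + binVal h + 2 else binVal h + binVal h + 1 := rfl
    rcases Nat.even_or_odd n with he | ho
    · refine ⟨true :: h, ?_, by simpa [hlog] using hl⟩
      rw [hcons, hv, cond_true]
      obtain ⟨m, rfl⟩ := he
      omega
    · refine ⟨false :: h, ?_, by simpa [hlog] using hl⟩
      rw [hcons, hv, cond_false]
      obtain ⟨m, rfl⟩ := ho
      omega

/-- Splits off a leading string that is preceded by the self-delimiting code of its length in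
bijective base two. -/
def splitLength (z : Str) : Str × Str :=
  let t := splitDelim z
  (t.2.take (binVal t.1), t.2.drop (binVal t.1))

theorem primrec_splitLength : Primrec splitLength := by
  have hn : Primrec fun z : Str => binVal (splitDelim z).1 :=
    primrec_binVal.comp (Primrec.fst.comp primrec_splitDelim)
  have ht : Primrec fun z : Str => (splitDelim z).2 := Primrec.snd.comp primrec_splitDelim
  exact (Primrec.list_take.comp hn ht).pair (Primrec.list_drop.comp hn ht)

theorem exists_splitLength_append (q : Str) :
    ∃ z : Str, z.length ≤ q.length + 3 * log2 q.length ∧ ∀ r, splitLength (z ++ r) = (q, r) := by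
  obtain ⟨h, hv, hl⟩ := exists_binVal_eq q.length
  have hlog : 1 ≤ log2 q.length := Nat.log_pos one_lt_two (by omega)
  have hmono : Nat.log 2 (q.length + 1) ≤ log2 q.length := Nat.log_mono_right (by omega)
  refine ⟨selfDelim h ++ q, ?_, fun r => ?_⟩
  · rw [List.length_append, length_selfDelim]; omega
  · simp [splitLength, List.append_assoc, splitDelim_selfDelim_append, hv]

/-- An encoding of triples of strings. -/
def encodeTriple (t : Str × Str × Str) : Str := selfDelim t.1 ++ (selfDelim t.2.1 ++ t.2.2)

/-- The decoder for `encodeTriple`. -/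
def decodeTriple (z : Str) : Str × Str × Str :=
  ((splitDelim z).1, splitDelim (splitDelim z).2)

theorem decodeTriple_encodeTriple (t : Str × Str × Str) : decodeTriple (encodeTriple t) = t := by
  simp [decodeTriple, encodeTriple, splitDelim_selfDelim_append]

theorem computable_encodeTriple : Computable encodeTriple :=
  (Primrec.list_append.comp (primrec_selfDelim.comp Primrec.fst)
    (Primrec.list_append.comp (primrec_selfDelim.comp (Primrec.fst.comp Primrec.snd))
      (Primrec.snd.comp Primrec.snd))).to_comp

theorem computable_decodeTriple : Computable decodeTriple :=
  ((Primrec.fst.comp primrec_splitDelim).pair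
    (primrec_splitDelim.comp (Primrec.snd.comp primrec_splitDelim))).to_comp

end Codes

/-! ### Basic properties of conditional complexity -/

section Complexity

variable {U : CondMachine}

theorem condC_le_of_mem (V : CondMachine) {x y p : Str} (h : x ∈ V.1 (p, y)) :
    condC V x y ≤ p.length :=
  sInf_le ⟨p, h, rfl⟩

theorem OptimalMachine.condC_ne_top (hU : OptimalMachine U) (x y : Str) : condC U x y ≠ ⊤ := by
  obtain ⟨d, hd⟩ := hU ⟨fun q => Part.some q.1, Computable.fst.partrec⟩
  refine ne_top_of_le_ne_top ?_
    ((hd x y).trans (add_le_add_left (condC_le_of_mem _ (Part.mem_some x)) _))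
  exact_mod_cast ENat.natCast_ne_top (x.length + d)

theorem OptimalMachine.exists_program (hU : OptimalMachine U) (x y : Str) :
    ∃ p : Str, x ∈ U.1 (p, y) ∧ p.length = KC U x y := by
  have hne : {n : ℕ∞ | ∃ p : Str, x ∈ U.1 (p, y) ∧ (p.length : ℕ∞) = n}.Nonempty := by
    by_contra h
    rw [Set.not_nonempty_iff_eq_empty] at h
    exact hU.condC_ne_top x y (by rw [condC, h, sInf_empty])
  obtain ⟨p, hp, hl⟩ := csInf_mem hne
  refine ⟨p, hp, ?_⟩
  rw [KC, condC, ← hl, ENat.toNat_natCast]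

theorem OptimalMachine.exists_KC_le (hU : OptimalMachine U) {V : Str × Str →. Str}
    (hV : Partrec V) : ∃ d : ℕ, ∀ x y p : Str, x ∈ V (p, y) → KC U x y ≤ p.length + d := by
  obtain ⟨d, hd⟩ := hU ⟨V, hV⟩
  refine ⟨d, fun x y p h => ?_⟩
  have hle := (hd x y).trans (add_le_add_left (condC_le_of_mem ⟨V, hV⟩ h) _)
  exact ENat.toNat_le_of_le_natCast (by exact_mod_cast hle)

theorem OptimalMachine.exists_KC_le_KC_comp (hU : OptimalMachine U) {f : Str → Str}
    (hf : Computable f) : ∃ d : ℕ, ∀ x y : Str, KC U x y ≤ KC U x (f y) + d := by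
  obtain ⟨d, hd⟩ := hU.exists_KC_le (V := fun q => U.1 (q.1, f q.2))
    (U.2.comp (Computable.fst.pair (hf.comp Computable.snd)))
  refine ⟨d, fun x y => ?_⟩
  obtain ⟨p, hp, hl⟩ := hU.exists_program x (f y)
  exact hl ▸ hd x y p hp

theorem OptimalMachine.exists_KC_le_KC_comp_of_finite (hU : OptimalMachine U) {ι : Type*}
    [Finite ι] {f : ι → Str → Str} (hf : ∀ i, Computable (f i)) :
    ∃ d : ℕ, ∀ i, ∀ x y : Str, KC U x y ≤ KC U x (f i y) + d := by
  choose d hd using fun i => hU.exists_KC_le_KC_comp (hf i)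
  obtain ⟨D, hD⟩ := (Set.finite_range d).bddAbove
  exact ⟨D, fun i x y => (hd i x y).trans (Nat.add_le_add_left (hD ⟨i, rfl⟩) _)⟩

/-- If a program for `x` can be computed from `y`, then `C(x|y) = O(1)`. -/
theorem OptimalMachine.exists_KC_le_of_program (hU : OptimalMachine U) {f : Str → Str}
    (hf : Computable f) : ∃ d : ℕ, ∀ x y : Str, x ∈ U.1 (f y, []) → KC U x y ≤ d := by
  obtain ⟨d, hd⟩ := hU.exists_KC_le (V := fun q => U.1 (f q.2, []))
    (U.2.comp ((hf.comp Computable.snd).pair (Computable.const [])))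
  exact ⟨d, fun x y h => by simpa using hd x y [] h⟩

theorem log2_mono {m n : ℕ} (h : m ≤ n) : log2 m ≤ log2 n := Nat.log_mono_right (by omega)

theorem one_le_log2 (n : ℕ) : 1 ≤ log2 n := Nat.log_pos one_lt_two (by omega)

/-- A triple is described by programs `q₁ ++ q₂` and `r₁ ++ r₂` for two of its entries together
with a program for the third one given the prefixes `q₁` and `r₁`. -/
theorem OptimalMachine.exists_KC_triple_le (hU : OptimalMachine U) {g : Str × Str × Str → Str}
    (hg : Computable g) {k : Str × Str → Str} (hk : Computable k) :
    ∃ K : ℕ, ∀ x b e q₁ q₂ r₁ r₂ : Str, b ∈ U.1 (q₁ ++ q₂, []) → e ∈ U.1 (r₁ ++ r₂, []) →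
      KC U (g (x, b, e)) [] ≤ KC U x (k (q₁, r₁)) + (q₁ ++ q₂).length + (r₁ ++ r₂).length +
        K * (log2 (q₁ ++ q₂).length + log2 (r₁ ++ r₂).length) := by
  have hs : Computable splitLength := primrec_splitLength.to_comp
  let Q₁ : Str → Str × Str := splitLength
  let Q₂ : Str → Str × Str := fun z => splitLength (Q₁ z).2
  let R₁ : Str → Str × Str := fun z => splitLength (Q₂ z).2
  let R₂ : Str → Str × Str := fun z => splitLength (R₁ z).2
  have hQ₂ : Computable Q₂ := hs.comp (Computable.snd.comp hs)
  have hR₁ : Computable R₁ := hs.comp (Computable.snd.comp hQ₂)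
  have hR₂ : Computable R₂ := hs.comp (Computable.snd.comp hR₁)
  have hfst {F : Str → Str × Str} (hF : Computable F) : Computable fun z => (F z).1 :=
    Computable.fst.comp hF
  let X : Str →. Str := fun z => U.1 ((R₂ z).2, k ((Q₁ z).1, (R₁ z).1))
  let B : Str →. Str := fun z => U.1 ((Q₁ z).1 ++ (Q₂ z).1, [])
  let E : Str →. Str := fun z => U.1 ((R₁ z).1 ++ (R₂ z).1, [])
  have hX : Partrec X := U.2.comp ((Computable.snd.comp hR₂).pair
    (hk.comp ((hfst hs).pair (hfst hR₁))))
  have hB : Partrec B := U.2.comp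
    ((Computable.list_append.comp (hfst hs) (hfst hQ₂)).pair (Computable.const []))
  have hE : Partrec E := U.2.comp
    ((Computable.list_append.comp (hfst hR₁) (hfst hR₂)).pair (Computable.const []))
  have hV : Partrec fun z : Str =>
      (X z).bind fun x => (B z).bind fun b => (E z).map fun e => g (x, b, e) := by
    refine hX.bind ?_
    refine Partrec.bind (hB.comp Computable.fst) ?_
    refine Partrec.map (hE.comp (Computable.fst.comp Computable.fst)) ?_
    exact hg.comp (((Computable.snd.comp (Computable.fst.comp Computable.fst))).pair
      ((Computable.snd.comp Computable.fst).pair Computable.snd))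
  obtain ⟨d, hd⟩ := hU.exists_KC_le (hV.comp (Computable.fst (β := Str)))
  refine ⟨d + 6, fun x b e q₁ q₂ r₁ r₂ hb he => ?_⟩
  obtain ⟨s, hs, hsl⟩ := hU.exists_program x (k (q₁, r₁))
  obtain ⟨zq₁, lq₁, sq₁⟩ := exists_splitLength_append q₁
  obtain ⟨zq₂, lq₂, sq₂⟩ := exists_splitLength_append q₂
  obtain ⟨zr₁, lr₁, sr₁⟩ := exists_splitLength_append r₁
  obtain ⟨zr₂, lr₂, sr₂⟩ := exists_splitLength_append r₂
  have hle := hd (g (x, b, e)) [] (zq₁ ++ (zq₂ ++ (zr₁ ++ (zr₂ ++ s)))) (by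
    simp only [Part.mem_bind_iff, Part.mem_map_iff]
    exact ⟨x, by simpa [X, Q₁, Q₂, R₁, R₂, sq₁, sq₂, sr₁, sr₂] using hs,
      b, by simpa [B, Q₁, Q₂, sq₁, sq₂] using hb,
      e, by simpa [E, Q₁, Q₂, R₁, R₂, sq₁, sq₂, sr₁, sr₂] using he, rfl⟩)
  have mq₁ : log2 q₁.length ≤ log2 (q₁ ++ q₂).length := log2_mono (by simp)
  have mq₂ : log2 q₂.length ≤ log2 (q₁ ++ q₂).length := log2_mono (by simp)
  have mr₁ : log2 r₁.length ≤ log2 (r₁ ++ r₂).length := log2_mono (by simp)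
  have mr₂ : log2 r₂.length ≤ log2 (r₁ ++ r₂).length := log2_mono (by simp)
  have one_le : 1 ≤ log2 (q₁ ++ q₂).length := one_le_log2 _
  simp only [List.length_append] at *
  nlinarith [Nat.zero_le (d * log2 (r₁.length + r₂.length))]

/-- A local modification of a string: no change, removal of the last bit, or appending a bit. -/
def modifyEnd : Option (Option Bool) → Str → Str
  | none, s => s
  | some none, s => s.take (s.length - 1)
  | some (some b), s => s ++ [b]

theorem computable_modifyEnd (m : Option (Option Bool)) : Computable (modifyEnd m) := by
  match m with
  | none => exact Computable.id
  | some none =>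
    exact (Primrec.list_take.comp (Primrec.pred.comp Primrec.list_length) Primrec.id).to_comp
  | some (some b) => exact Computable.list_concat.comp Computable.id (Computable.const b)

theorem exists_modifyEnd_take_eq_take_add (p : Str) (i : ℕ) (u : Bool) :
    ∃ m, modifyEnd m (p.take i) = p.take (i + u.toNat) := by
  rcases u with _ | _
  · exact ⟨none, rfl⟩
  rcases lt_or_ge i p.length with h | h
  · exact ⟨some (some p[i]), (List.take_succ_eq_append_getElem h).symm⟩
  · exact ⟨none, by simp [modifyEnd, List.take_of_length_le h,
      List.take_of_length_le (Nat.le_succ_of_le h)]⟩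

theorem exists_modifyEnd_take_add_eq_take (p : Str) (i : ℕ) (u : Bool) :
    ∃ m, modifyEnd m (p.take (i + u.toNat)) = p.take i := by
  rcases u with _ | _
  · exact ⟨none, rfl⟩
  rcases lt_or_ge i p.length with h | h
  · refine ⟨some none, ?_⟩
    have hmin : min (i + 1) p.length = i + 1 := min_eq_left h
    simp [modifyEnd, List.take_take, hmin]
  · exact ⟨none, by simp [modifyEnd, List.take_of_length_le h,
      List.take_of_length_le (Nat.le_succ_of_le h)]⟩

/-- The condition formed from the prefixes of `p`, `q`, `r` of lengths `i`, `j`, `k`. -/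
def prefixCond (p q r : Str) (i j k : ℕ) : Str := encodeTriple (p.take i, q.take j, r.take k)

/-- Complexity conditional on prefixes changes by `O(1)` within a unit cube. -/
theorem OptimalMachine.exists_abs_KC_prefixCond_sub_le (hU : OptimalMachine U) :
    ∃ L : ℕ, ∀ x p q r : Str, ∀ i j k (u v w : Bool),
      |(KC U x (prefixCond p q r (i + u.toNat) (j + v.toNat) (k + w.toNat)) : ℤ) -
        KC U x (prefixCond p q r i j k)| ≤ L := by
  let M := Option (Option Bool)
  let f (m : M × M × M) (z : Str) : Str :=
    encodeTriple (modifyEnd m.1 (decodeTriple z).1, modifyEnd m.2.1 (decodeTriple z).2.1,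
      modifyEnd m.2.2 (decodeTriple z).2.2)
  have hf (m : M × M × M) : Computable (f m) := by
    have h2 := Computable.snd.comp computable_decodeTriple
    exact computable_encodeTriple.comp
      (((computable_modifyEnd m.1).comp (Computable.fst.comp computable_decodeTriple)).pair
        (((computable_modifyEnd m.2.1).comp (Computable.fst.comp h2)).pair
          ((computable_modifyEnd m.2.2).comp (Computable.snd.comp h2))))
  obtain ⟨L, hL⟩ := hU.exists_KC_le_KC_comp_of_finite hf
  refine ⟨L, fun x p q r i j k u v w => ?_⟩
  obtain ⟨m₁, h₁⟩ := exists_modifyEnd_take_eq_take_add p i u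
  obtain ⟨m₂, h₂⟩ := exists_modifyEnd_take_eq_take_add q j v
  obtain ⟨m₃, h₃⟩ := exists_modifyEnd_take_eq_take_add r k w
  obtain ⟨n₁, g₁⟩ := exists_modifyEnd_take_add_eq_take p i u
  obtain ⟨n₂, g₂⟩ := exists_modifyEnd_take_add_eq_take q j v
  obtain ⟨n₃, g₃⟩ := exists_modifyEnd_take_add_eq_take r k w
  have up := hL (m₁, m₂, m₃) x (prefixCond p q r i j k)
  have down := hL (n₁, n₂, n₃) x (prefixCond p q r (i + u.toNat) (j + v.toNat) (k + w.toNat))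
  simp only [f, prefixCond, decodeTriple_encodeTriple, h₁, h₂, h₃, g₁, g₂, g₃] at up down ⊢
  rw [abs_le]
  omega

end Complexity

/-- Three-dimensional version of Theorem 2: given a computable injective
pairing, for all strings `a, b, e` and all integers `α, β, γ` that are at least
`c·δ` away from the endpoints of `[0, C(a)]`, `[0, C(b)]`, `[0, C(e)]`
respectively, where
`δ = log C(a) + log C(b) + log C(e) + max(0, C(a) + C(b) + C(e) - C(a,b,e))`,
there exists a string `y` with `C(a|y) = α + O(1)`, `C(b|y) = β + O(1)`, and
`C(e|y) = γ + O(1)`. -/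
theorem decrease_complexity_by_oracle_three (U : CondMachine) (hU : OptimalMachine U)
    (pair : Str → Str → Str)
    (hpair_comp : Computable fun p : Str × Str => pair p.1 p.2)
    (hpair_inj : Function.Injective fun p : Str × Str => pair p.1 p.2) :
    ∃ c : ℕ, ∀ a b e : Str,
      ∀ α β γ : ℤ,
        (c : ℤ) * ((log2 (KC U a []) : ℤ) + (log2 (KC U b []) : ℤ) + (log2 (KC U e []) : ℤ)
            + max 0 ((KC U a [] : ℤ) + (KC U b [] : ℤ) + (KC U e [] : ℤ)
                - (KC U (pair a (pair b e)) [] : ℤ))) ≤ α →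
        α ≤ (KC U a [] : ℤ) -
          (c : ℤ) * ((log2 (KC U a []) : ℤ) + (log2 (KC U b []) : ℤ) + (log2 (KC U e []) : ℤ)
            + max 0 ((KC U a [] : ℤ) + (KC U b [] : ℤ) + (KC U e [] : ℤ)
                - (KC U (pair a (pair b e)) [] : ℤ))) →
        (c : ℤ) * ((log2 (KC U a []) : ℤ) + (log2 (KC U b []) : ℤ) + (log2 (KC U e []) : ℤ)
            + max 0 ((KC U a [] : ℤ) + (KC U b [] : ℤ) + (KC U e [] : ℤ)
                - (KC U (pair a (pair b e)) [] : ℤ))) ≤ β →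
        β ≤ (KC U b [] : ℤ) -
          (c : ℤ) * ((log2 (KC U a []) : ℤ) + (log2 (KC U b []) : ℤ) + (log2 (KC U e []) : ℤ)
            + max 0 ((KC U a [] : ℤ) + (KC U b [] : ℤ) + (KC U e [] : ℤ)
                - (KC U (pair a (pair b e)) [] : ℤ))) →
        (c : ℤ) * ((log2 (KC U a []) : ℤ) + (log2 (KC U b []) : ℤ) + (log2 (KC U e []) : ℤ)
            + max 0 ((KC U a [] : ℤ) + (KC U b [] : ℤ) + (KC U e [] : ℤ)
                - (KC U (pair a (pair b e)) [] : ℤ))) ≤ γ →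
        γ ≤ (KC U e [] : ℤ) -
          (c : ℤ) * ((log2 (KC U a []) : ℤ) + (log2 (KC U b []) : ℤ) + (log2 (KC U e []) : ℤ)
            + max 0 ((KC U a [] : ℤ) + (KC U b [] : ℤ) + (KC U e [] : ℤ)
                - (KC U (pair a (pair b e)) [] : ℤ))) →
        ∃ y : Str, |(KC U a y : ℤ) - α| ≤ (c : ℤ) ∧ |(KC U b y : ℤ) - β| ≤ (c : ℤ) ∧
          |(KC U e y : ℤ) - γ| ≤ (c : ℤ) := by
  obtain ⟨L, hL⟩ := hU.exists_abs_KC_prefixCond_sub_le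
  have hsnd := Computable.snd.comp computable_decodeTriple
  obtain ⟨da, hda⟩ := hU.exists_KC_le_of_program (Computable.fst.comp computable_decodeTriple)
  obtain ⟨db, hdb⟩ := hU.exists_KC_le_of_program (Computable.fst.comp hsnd)
  obtain ⟨de, hde⟩ := hU.exists_KC_le_of_program (Computable.snd.comp hsnd)
  have pair_comp {τ : Type} [Primcodable τ] {f g : τ → Str} (hf : Computable f)
      (hg : Computable g) : Computable fun t => pair (f t) (g t) := hpair_comp.comp (hf.pair hg)
  have fst3 : Computable fun t : Str × Str × Str => t.1 := Computable.fst
  have snd3 : Computable fun t : Str × Str × Str => t.2.1 := Computable.fst.comp Computable.snd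
  have thd3 : Computable fun t : Str × Str × Str => t.2.2 := Computable.snd.comp Computable.snd
  have fst2 : Computable fun t : Str × Str => t.1 := Computable.fst
  have snd2 : Computable fun t : Str × Str => t.2 := Computable.snd
  have nil2 : Computable fun _ : Str × Str => ([] : Str) := Computable.const []
  obtain ⟨Ka, hKa⟩ := hU.exists_KC_triple_le (pair_comp fst3 (pair_comp snd3 thd3))
    (computable_encodeTriple.comp (nil2.pair (fst2.pair snd2)))
  obtain ⟨Kb, hKb⟩ := hU.exists_KC_triple_le (pair_comp snd3 (pair_comp fst3 thd3))
    (computable_encodeTriple.comp (fst2.pair (nil2.pair snd2)))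
  obtain ⟨Ke, hKe⟩ := hU.exists_KC_triple_le (pair_comp snd3 (pair_comp thd3 fst3))
    (computable_encodeTriple.comp (fst2.pair (snd2.pair nil2)))
  refine ⟨L + da + db + de + Ka + Kb + Ke + 1, fun a b e α β γ hα hα' hβ hβ' hγ hγ' => ?_⟩
  obtain ⟨p, hp, lp⟩ := hU.exists_program a []
  obtain ⟨q, hq, lq⟩ := hU.exists_program b []
  obtain ⟨r, hr, lr⟩ := hU.exists_program e []
  set c : ℕ := L + da + db + de + Ka + Kb + Ke + 1 with hc
  set S : ℤ := (KC U a [] : ℤ) + KC U b [] + KC U e [] - KC U (pair a (pair b e)) [] with hS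
  set δ : ℤ := (log2 (KC U a []) : ℤ) + log2 (KC U b []) + log2 (KC U e []) + max 0 S with hδ
  have hla := one_le_log2 (KC U a [])
  have hlb := one_le_log2 (KC U b [])
  have hle := one_le_log2 (KC U e [])
  have hSmax : S ≤ max 0 S := le_max_right 0 S
  have hmax : 0 ≤ max 0 S := le_max_left 0 S
  have hδ1 : 1 ≤ δ := by omega
  have hcδ : (c : ℤ) ≤ c * δ := le_mul_of_one_le_right (by positivity) hδ1
  have near {K l m : ℕ} (hK : K + 1 ≤ c) (hlm : (l + m : ℕ) + max 0 S ≤ δ) :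
      ((K * (l + m) : ℕ) : ℤ) + S ≤ c * δ := by
    have hc' : ((K : ℤ) + 1) * δ ≤ c * δ :=
      mul_le_mul_of_nonneg_right (by exact_mod_cast hK) (by omega)
    have hK' : (K : ℤ) * ((l + m : ℕ) : ℤ) ≤ K * δ :=
      mul_le_mul_of_nonneg_left (by omega) (by positivity)
    push_cast at hK' hlm ⊢
    nlinarith
  have nearA := near (K := Ka) (l := log2 (KC U b [])) (m := log2 (KC U e [])) (by omega) (by omega)
  have nearB := near (K := Kb) (l := log2 (KC U a [])) (m := log2 (KC U e [])) (by omega) (by omega)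
  have nearE := near (K := Ke) (l := log2 (KC U a [])) (m := log2 (KC U b [])) (by omega) (by omega)
  have take_drop (s : Str) (i : ℕ) : s.take i ++ s.drop i = s := List.take_append_drop i s
  obtain ⟨i, j, k, hi, hj, hk⟩ := exists_abs_le_of_sign_change
    (M := p.length) (N := q.length) (P := r.length) (L := L)
    (f := fun i j k => KC U a (prefixCond p q r i j k) - α)
    (g := fun i j k => KC U b (prefixCond p q r i j k) - β)
    (h := fun i j k => KC U e (prefixCond p q r i j k) - γ)
    (fun j k => by
      have := hKa a b e (q.take j) (q.drop j) (r.take k) (r.drop k)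
        (by rwa [take_drop]) (by rwa [take_drop])
      simp only [take_drop, lq, lr] at this
      simp only [prefixCond, List.take_zero]
      omega)
    (fun j k => by
      have := hda a (prefixCond p q r p.length j k)
        (by simpa [prefixCond, decodeTriple_encodeTriple] using hp)
      omega)
    (fun i k => by
      have := hKb b a e (p.take i) (p.drop i) (r.take k) (r.drop k)
        (by rwa [take_drop]) (by rwa [take_drop])
      simp only [take_drop, lp, lr] at this
      simp only [prefixCond, List.take_zero]
      omega)
    (fun i k => by
      have := hdb b (prefixCond p q r i q.length k)
        (by simpa [prefixCond, decodeTriple_encodeTriple] using hq)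
      omega)
    (fun i j => by
      have := hKe e a b (p.take i) (p.drop i) (q.take j) (q.drop j)
        (by rwa [take_drop]) (by rwa [take_drop])
      simp only [take_drop, lp, lq] at this
      simp only [prefixCond, List.take_zero]
      omega)
    (fun i j => by
      have := hde e (prefixCond p q r i j r.length)
        (by simpa [prefixCond, decodeTriple_encodeTriple] using hr)
      omega)
    (fun i j k u v w => by simpa using hL a p q r i j k u v w)
    (fun i j k u v w => by simpa using hL b p q r i j k u v w)
    (fun i j k u v w => by simpa using hL e p q r i j k u v w)
  have hLc : (L : ℤ) ≤ c := by omega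
  exact ⟨prefixCond p q r i j k, hi.trans hLc, hj.trans hLc, hk.trans hLc⟩
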